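/- arXiv:1301.5515 — 2 statements merged into one kernel-verified Lean document; each statement's English description precedes it below -/
import Mathlib

section
/- Let a, b, c ∈ ℝ³ be pairwise at distance 1 from each other. Then the Lebesgue volume of the intersection closedBall a 1 ∩ closedBall b 1 ∩ closedBall c 1 (the spherical trihedron) equals (1/12)·[2√2 + 24π − 57·arccos(1/3)]. -/
open MeasureTheory Metric Real

lemma seg_integral (ρ d : ℝ) (hρ : 0 < ρ) (hd : 0 ≤ d) (hdρ : d ≤ ρ) :
    ∫ x in d..ρ, 2 * √(ρ^2 - x^2) = ρ^2 * arccos (d/ρ) - d * √(ρ^2 - d^2) := by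
  have key : ∀ x ∈ Set.Ioo d ρ, HasDerivAt (fun x => x * √(ρ^2 - x^2) - ρ^2 * arccos (x/ρ))
      (2 * √(ρ^2 - x^2)) x := by
    rintro x ⟨h1, h2⟩
    have hpos : 0 < ρ^2 - x^2 := by nlinarith
    have hs : 0 < √(ρ^2 - x^2) := Real.sqrt_pos.2 hpos
    have hsq : √(ρ^2 - x^2)^2 = ρ^2 - x^2 := Real.sq_sqrt hpos.le
    have e1 : HasDerivAt (fun x : ℝ => ρ^2 - x^2) (-(2*x)) x := by
      simpa using ((hasDerivAt_id x).pow 2).const_sub (ρ^2)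
    have e2 := e1.sqrt hpos.ne'
    have hlt : x/ρ < 1 := by rw [div_lt_one hρ]; exact h2
    have hge : 0 ≤ x/ρ := by have : 0 ≤ x := by linarith
                             positivity
    have e3 : HasDerivAt (fun x : ℝ => arccos (x/ρ)) (-(1 / √(1 - (x/ρ)^2)) * (1/ρ)) x :=
      HasDerivAt.comp (h₂ := arccos) (h := fun x : ℝ => x/ρ) x
        (Real.hasDerivAt_arccos (by linarith) hlt.ne) ((hasDerivAt_id x).div_const ρ)
    have hr : √(1 - (x/ρ)^2) = √(ρ^2 - x^2) / ρ := by
      rw [show 1 - (x/ρ)^2 = (ρ^2 - x^2)/ρ^2 by field_simp, Real.sqrt_div hpos.le,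
        Real.sqrt_sq hρ.le]
    rw [hr] at e3
    have e4 := ((hasDerivAt_id x).mul e2).sub (e3.const_mul (ρ^2))
    refine e4.congr_deriv ?_
    simp only [id]
    field_simp
    rw [hsq]; ring
  rw [intervalIntegral.integral_eq_sub_of_hasDerivAt_of_le hdρ _ key]
  · rw [div_self hρ.ne']; simp
  · apply Continuous.intervalIntegrable; fun_prop
  · have := Real.continuous_arccos
    apply Continuous.continuousOn; fun_prop

lemma seg_nonneg (ρ d : ℝ) (hρ : 0 < ρ) (hd : 0 ≤ d) (hdρ : d ≤ ρ) :
    0 ≤ ρ^2 * arccos (d/ρ) - d * √(ρ^2 - d^2) := by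
  rw [← seg_integral ρ d hρ hd hdρ]
  apply intervalIntegral.integral_nonneg hdρ
  intros; positivity

lemma seg_area (ρ d : ℝ) (hρ : 0 < ρ) (hd : 0 ≤ d) (hdρ : d ≤ ρ) :
    volume {p : ℝ × ℝ | p.1^2 + p.2^2 ≤ ρ^2 ∧ d ≤ p.1} =
      ENNReal.ofReal (ρ^2 * arccos (d/ρ) - d * √(ρ^2 - d^2)) := by
  have hm : MeasurableSet {p : ℝ × ℝ | p.1^2 + p.2^2 ≤ ρ^2 ∧ d ≤ p.1} := by
    apply IsClosed.measurableSet
    have h1 : IsClosed {p : ℝ × ℝ | p.1^2 + p.2^2 ≤ ρ^2} :=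
      isClosed_le (by fun_prop) (by fun_prop)
    have h2 : IsClosed {p : ℝ × ℝ | d ≤ p.1} := isClosed_le (by fun_prop) (by fun_prop)
    exact h1.inter h2
  rw [Measure.volume_eq_prod, Measure.prod_apply hm, ← seg_integral ρ d hρ hd hdρ]
  have : ∀ x : ℝ, volume (Prod.mk x ⁻¹' {p : ℝ × ℝ | p.1^2 + p.2^2 ≤ ρ^2 ∧ d ≤ p.1}) =
      (Set.Icc d ρ).indicator (fun x => ENNReal.ofReal (2 * √(ρ^2 - x^2))) x := by
    intro x
    by_cases hx : x ∈ Set.Icc d ρ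
    · rw [Set.indicator_of_mem hx]
      have hn : 0 ≤ ρ^2 - x^2 := by nlinarith [hx.1, hx.2]
      have : Prod.mk x ⁻¹' {p : ℝ × ℝ | p.1^2 + p.2^2 ≤ ρ^2 ∧ d ≤ p.1} =
          Set.Icc (-√(ρ^2 - x^2)) (√(ρ^2 - x^2)) := by
        ext z
        simp only [Set.mem_preimage, Set.mem_ofPred_eq, Set.mem_Icc]
        rw [← abs_le, ← Real.sqrt_sq_eq_abs, Real.sqrt_le_sqrt_iff hn]
        constructor
        · rintro ⟨h, _⟩; linarith
        · intro h; exact ⟨by linarith, hx.1⟩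
      rw [this, Real.volume_Icc]; congr 1; ring
    · rw [Set.indicator_of_notMem hx]
      have : Prod.mk x ⁻¹' {p : ℝ × ℝ | p.1^2 + p.2^2 ≤ ρ^2 ∧ d ≤ p.1} = ∅ := by
        ext z
        simp only [Set.mem_preimage, Set.mem_ofPred_eq, Set.mem_empty_iff_false, iff_false]
        rintro ⟨h, h'⟩
        exact hx ⟨h', by nlinarith [sq_nonneg z]⟩
      rw [this]; simp
  simp_rw [this]
  rw [lintegral_indicator measurableSet_Icc, intervalIntegral.integral_of_le hdρ,
    ← integral_Icc_eq_integral_Ioc, ofReal_integral_eq_lintegral_ofReal]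
  · apply Continuous.integrableOn_Icc; fun_prop
  · apply Filter.Eventually.of_forall; intro x; simp only [Pi.zero_apply]; positivity

noncomputable def hh (y : ℝ) : ℝ :=
  (1 - y^2) * arccos (√((1+y)/(3*(1-y)))) - (1+y)/3 * √((1+y)*(2-4*y))

lemma hh_eq (y : ℝ) (h0 : 0 ≤ y) (h1 : y ≤ 1/2) :
    (√(1-y^2))^2 * arccos (((1+y)/√3)/√(1-y^2))
      - ((1+y)/√3) * √((√(1-y^2))^2 - ((1+y)/√3)^2) = hh y := by
  have hp : 0 < 1 - y^2 := by nlinarith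
  have h3 : √3 ^ 2 = 3 := Real.sq_sqrt (by norm_num)
  have a1 : ((1+y)/√3)/√(1-y^2) = √((1+y)/(3*(1-y))) := by
    rw [eq_comm, Real.sqrt_eq_iff_mul_self_eq (by apply div_nonneg <;> linarith) (by positivity)]
    rw [← pow_two, div_pow, div_pow, h3, Real.sq_sqrt hp.le]
    have : 1 - y ≠ 0 := by linarith
    have : 1 + y ≠ 0 := by linarith
    rw [show 1 - y^2 = (1-y)*(1+y) by ring]
    field_simp
  have a2 : √((√(1-y^2))^2 - ((1+y)/√3)^2) = √((1+y)*(2-4*y)) / √3 := by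
    rw [← Real.sqrt_div' _ (by norm_num), Real.sq_sqrt hp.le, div_pow, h3]
    congr 1; ring
  rw [a1, a2, Real.sq_sqrt hp.le, hh]
  congr 1
  field_simp
  rw [h3]; ring

lemma hh_cont : ContinuousOn hh (Set.Icc 0 (1/2)) := by
  have := Real.continuous_arccos
  unfold hh
  apply ContinuousOn.sub
  · apply ContinuousOn.mul (by fun_prop)
    apply this.comp_continuousOn
    apply ContinuousOn.sqrt
    apply ContinuousOn.div (by fun_prop) (by fun_prop)
    rintro x ⟨_, h⟩; linarith
  · fun_prop

lemma hh_integral : ∫ y in (0:ℝ)..(1/2), hh y =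
    (1/72) * (2 * √2 + 24 * π - 57 * arccos (1/3)) := by
  have key : ∀ y ∈ Set.Ioo (0:ℝ) (1/2), HasDerivAt (fun y : ℝ =>
      (y - y^3/3 - 2/3) * arccos (√((1+y)/(3*(1-y)))) - (4*y^2+8*y+1)/36 * √((1+y)*(2-4*y))
       - (11/24) * arcsin ((4*y+1)/3)) (hh y) y := by
    rintro y ⟨h0, h1⟩
    have hy : 0 < 1 - y := by linarith
    have hy' : 0 < 1 + y := by linarith
    have hQ : 0 < (1+y)*(2-4*y) := by apply mul_pos <;> linarith
    set s := √((1+y)*(2-4*y)) with hs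
    have hs0 : 0 < s := Real.sqrt_pos.2 hQ
    have hs2 : s^2 = (1+y)*(2-4*y) := Real.sq_sqrt hQ.le
    have e1 : HasDerivAt (fun y : ℝ => √((1+y)*(2-4*y))) ((-1-4*y)/s) y := by
      have : HasDerivAt (fun y : ℝ => (1+y)*(2-4*y)) (1*(2-4*y) + (1+y)*(-(4*1))) y :=
        ((hasDerivAt_id y).const_add 1).mul (((hasDerivAt_id y).const_mul 4).const_sub 2)
      refine (this.sqrt hQ.ne').congr_deriv ?_
      rw [← hs]; field_simp; ring
    have e2 : HasDerivAt (fun y : ℝ => arcsin ((4*y+1)/3)) (2/s) y := by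
      have : HasDerivAt (fun y : ℝ => (4*y+1)/3) ((4*1)/3) y :=
        (((hasDerivAt_id y).const_mul 4).add_const 1).div_const 3
      have h := (Real.hasDerivAt_arcsin (x := (4*y+1)/3) (by linarith) (by linarith)).comp y this
      refine h.congr_deriv ?_
      have : √(1 - ((4*y+1)/3)^2) = 2 * s/3 := by
        rw [Real.sqrt_eq_iff_mul_self_eq (by nlinarith) (by positivity)]
        linear_combination (-4/9) * hs2
      rw [this]; field_simp; norm_num
    have e3 : HasDerivAt (fun y : ℝ => arccos (√((1+y)/(3*(1-y))))) (-1/((1-y)*s)) y := by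
      have hu : 0 < (1+y)/(3*(1-y)) := by positivity
      have hu1 : (1+y)/(3*(1-y)) < 1 := by rw [div_lt_one (by positivity)]; linarith
      set u := √((1+y)/(3*(1-y))) with hu'
      have hu0 : 0 < u := Real.sqrt_pos.2 hu
      have hu2 : u^2 = (1+y)/(3*(1-y)) := Real.sq_sqrt hu.le
      have d1 : HasDerivAt (fun y : ℝ => (1+y)/(3*(1-y)))
          ((1 * (3*(1-y)) - (1+y)*(3*(-1)))/(3*(1-y))^2) y :=
        ((hasDerivAt_id y).const_add 1).div (((hasDerivAt_id y).const_sub 1).const_mul 3)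
          (by positivity)
      have d2 := d1.sqrt hu.ne'
      rw [← hu'] at d2
      have hlt : u < 1 := by nlinarith
      have h := (Real.hasDerivAt_arccos (x := u) (by linarith) hlt.ne).comp y d2
      refine h.congr_deriv ?_
      have hw : √(1 - u^2) = s / (3*(1-y)*u) := by
        rw [Real.sqrt_eq_iff_mul_self_eq (by nlinarith) (by positivity), ← pow_two, div_pow,
          mul_pow, hu2, hs2]
        field_simp; ring
      rw [hw]; field_simp; ring
    have e0 : HasDerivAt (fun y : ℝ => y - y^3/3 - 2/3) (1 - y^2) y := by
      have := (((hasDerivAt_id y).sub (((hasDerivAt_id y).pow 3).div_const 3)).sub_const (2/3))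
      refine this.congr_deriv ?_
      simp
    have e4 : HasDerivAt (fun y : ℝ => (4*y^2+8*y+1)/36) ((8*y+8)/36) y := by
      have := ((((((hasDerivAt_id y).pow 2).const_mul 4).add ((hasDerivAt_id y).const_mul 8)).add_const 1).div_const 36)
      refine this.congr_deriv ?_
      simp; ring
    have := ((e0.mul e3).sub (e4.mul e1)).sub (e2.const_mul (11/24))
    refine this.congr_deriv ?_
    rw [hh, ← hs]
    rw [← sub_eq_zero]
    field_simp
    ring_nf
    have hs3 : s^3 = s * ((1+y)*(2-4*y)) := by rw [← hs2]; ring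
    try rw [hs3]
    try rw [hs2]
    ring
  have hint : IntervalIntegrable hh volume 0 (1/2) := by
    apply ContinuousOn.intervalIntegrable
    rw [Set.uIcc_of_le (by norm_num)]; exact hh_cont
  rw [intervalIntegral.integral_eq_sub_of_hasDerivAt_of_le (by norm_num) _ key hint]
  · have q1 : arccos (√(1/3)) = (π - arccos (1/3))/2 := by
      have h0 := Real.arccos_nonneg (1/3)
      have h1 := Real.arccos_le_pi (1/3)
      rw [← Real.arccos_cos (x := (π - arccos (1/3))/2) (by linarith) (by linarith)]
      congr 1
      rw [Real.cos_half (by linarith) (by linarith), Real.cos_pi_sub, Real.cos_arccos (by norm_num) (by norm_num)]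
      norm_num
    have q2 := Real.arccos_eq_pi_div_two_sub_arcsin (1/3)
    norm_num
    norm_num at q1 q2
    rw [q1, q2]; ring
  · have := Real.continuous_arccos
    have := Real.continuous_arcsin
    apply ContinuousOn.sub _ (by fun_prop)
    apply ContinuousOn.sub _ (by fun_prop)
    apply ContinuousOn.mul (by fun_prop)
    apply Real.continuous_arccos.comp_continuousOn
    apply ContinuousOn.sqrt
    apply ContinuousOn.div (by fun_prop) (by fun_prop)
    rintro x ⟨_, h⟩; linarith

lemma hh_nonneg (y : ℝ) (h0 : 0 ≤ y) (h1 : y ≤ 1/2) : 0 ≤ hh y ∧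
    volume {p : ℝ × ℝ | p.1^2 + y^2 + p.2^2 ≤ 1 ∧ 1 + y ≤ √3 * p.1} = ENNReal.ofReal (hh y) := by
  have hp : 0 < 1 - y^2 := by nlinarith
  have h3 : √3 ^ 2 = 3 := Real.sq_sqrt (by norm_num)
  have h30 : 0 < √3 := by positivity
  have hd : (1+y)/√3 ≤ √(1-y^2) := by
    apply Real.le_sqrt_of_sq_le
    rw [div_pow, h3]; nlinarith
  have hd0 : 0 ≤ (1+y)/√3 := by positivity
  rw [← hh_eq y h0 h1]
  refine ⟨seg_nonneg _ _ (Real.sqrt_pos.2 hp) hd0 hd, ?_⟩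
  rw [← seg_area _ _ (Real.sqrt_pos.2 hp) hd0 hd]
  congr 1
  ext p
  simp only [Set.mem_ofPred_eq]
  rw [Real.sq_sqrt hp.le, div_le_iff₀ h30, mul_comm p.1]
  constructor
  · rintro ⟨h, h'⟩; exact ⟨by linarith, h'⟩
  · rintro ⟨h, h'⟩; exact ⟨by linarith, h'⟩

lemma piece_prod :
    volume {p : ℝ × (ℝ × ℝ) | p.2.1^2 + p.1^2 + p.2.2^2 ≤ 1 ∧ 1 + |p.1| ≤ √3 * p.2.1} =
      ENNReal.ofReal ((1/36) * (2 * √2 + 24 * π - 57 * arccos (1/3))) := by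
  have hm : MeasurableSet {p : ℝ × (ℝ × ℝ) | p.2.1^2 + p.1^2 + p.2.2^2 ≤ 1 ∧ 1 + |p.1| ≤ √3 * p.2.1} := by
    apply IsClosed.measurableSet
    have h1 : IsClosed {p : ℝ × (ℝ × ℝ) | p.2.1^2 + p.1^2 + p.2.2^2 ≤ 1} :=
      isClosed_le (by fun_prop) (by fun_prop)
    have h2 : IsClosed {p : ℝ × (ℝ × ℝ) | 1 + |p.1| ≤ √3 * p.2.1} :=
      isClosed_le (by fun_prop) (by fun_prop)
    exact h1.inter h2
  rw [Measure.volume_eq_prod, Measure.prod_apply hm]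
  have : ∀ y : ℝ, volume (Prod.mk y ⁻¹' {p : ℝ × (ℝ × ℝ) | p.2.1^2 + p.1^2 + p.2.2^2 ≤ 1 ∧ 1 + |p.1| ≤ √3 * p.2.1}) =
      (Set.Icc (-(1/2)) (1/2)).indicator (fun y => ENNReal.ofReal (hh |y|)) y := by
    intro y
    by_cases hy : y ∈ Set.Icc (-(1/2):ℝ) (1/2)
    · rw [Set.indicator_of_mem hy, ← (hh_nonneg |y| (abs_nonneg y) (abs_le.2 hy)).2]
      congr 1
      ext p
      simp only [Set.mem_preimage, Set.mem_ofPred_eq, sq_abs]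
    · rw [Set.indicator_of_notMem hy]
      have : Prod.mk y ⁻¹' {p : ℝ × (ℝ × ℝ) | p.2.1^2 + p.1^2 + p.2.2^2 ≤ 1 ∧ 1 + |p.1| ≤ √3 * p.2.1} = ∅ := by
        ext p
        simp only [Set.mem_preimage, Set.mem_ofPred_eq, Set.mem_empty_iff_false, iff_false]
        rintro ⟨h, h'⟩
        apply hy
        rw [Set.mem_Icc, ← abs_le]
        have h3 : √3 ^ 2 = 3 := Real.sq_sqrt (by norm_num)
        have h0 := abs_nonneg y
        have k : (1 + |y|)^2 ≤ (√3 * p.1)^2 := by gcongr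
        rw [mul_pow, h3] at k
        rw [← sq_abs y] at h
        nlinarith [sq_nonneg p.2]
      rw [this]; simp
  simp_rw [this]
  have hc : ContinuousOn (fun y => hh |y|) (Set.Icc (-(1/2)) (1/2)) :=
    hh_cont.comp (by fun_prop) (fun y hy => ⟨abs_nonneg y, abs_le.2 hy⟩)
  rw [lintegral_indicator measurableSet_Icc, ← ofReal_integral_eq_lintegral_ofReal,
    integral_Icc_eq_integral_Ioc, ← intervalIntegral.integral_of_le (by norm_num)]
  · congr 1
    have i1 : IntervalIntegrable (fun y => hh |y|) volume (-(1/2)) 0 := by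
      apply ContinuousOn.intervalIntegrable
      rw [Set.uIcc_of_le (by norm_num)]
      exact hc.mono (Set.Icc_subset_Icc_right (by norm_num))
    have i2 : IntervalIntegrable (fun y => hh |y|) volume 0 (1/2) := by
      apply ContinuousOn.intervalIntegrable
      rw [Set.uIcc_of_le (by norm_num)]
      exact hc.mono (Set.Icc_subset_Icc_left (by norm_num))
    rw [← intervalIntegral.integral_add_adjacent_intervals i1 i2]
    have j2 : ∫ y in (0:ℝ)..(1/2), hh |y| = ∫ y in (0:ℝ)..(1/2), hh y := by
      apply intervalIntegral.integral_congr
      intro y hy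
      rw [Set.uIcc_of_le (by norm_num)] at hy
      simp only [abs_of_nonneg hy.1]
    have j1 : ∫ y in (-(1/2):ℝ)..0, hh |y| = ∫ y in (0:ℝ)..(1/2), hh |y| := by
      have := intervalIntegral.integral_comp_neg (a := 0) (b := 1/2) (fun y => hh |y|)
      simpa using this.symm
    rw [j1, j2, hh_integral]; ring
  · exact hc.integrableOn_Icc
  · filter_upwards [ae_restrict_mem measurableSet_Icc] with y hy
    exact (hh_nonneg |y| (abs_nonneg y) (abs_le.2 hy)).1

def PP : Set (EuclideanSpace ℝ (Fin 3)) := {v | v 0^2 + v 1^2 + v 2^2 ≤ 1 ∧ 1 + |v 1| ≤ √3 * v 0}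

lemma PP_closed : IsClosed PP := by
  have h1 : IsClosed {v : EuclideanSpace ℝ (Fin 3) | v 0^2 + v 1^2 + v 2^2 ≤ 1} :=
      isClosed_le (by fun_prop) (by fun_prop)
  have h2 : IsClosed {v : EuclideanSpace ℝ (Fin 3) | 1 + |v 1| ≤ √3 * v 0} :=
      isClosed_le (by fun_prop) (by fun_prop)
  exact h1.inter h2

lemma PP_vol : volume PP = ENNReal.ofReal ((1/36) * (2 * √2 + 24 * π - 57 * arccos (1/3))) := by
  rw [← piece_prod]
  have m1 := PiLp.volume_preserving_ofLp (Fin 3)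
  have m2 := volume_preserving_piFinSuccAbove (fun _ : Fin 3 => ℝ) 1
  have m3 := (MeasurePreserving.id (volume : Measure ℝ)).prod (volume_preserving_finTwoArrow ℝ)
  have m := (m3.comp m2).comp m1
  have hm : MeasurableSet {p : ℝ × (ℝ × ℝ) | p.2.1^2 + p.1^2 + p.2.2^2 ≤ 1 ∧ 1 + |p.1| ≤ √3 * p.2.1} := by
    apply IsClosed.measurableSet
    have h1 : IsClosed {p : ℝ × (ℝ × ℝ) | p.2.1^2 + p.1^2 + p.2.2^2 ≤ 1} :=
      isClosed_le (by fun_prop) (by fun_prop)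
    have h2 : IsClosed {p : ℝ × (ℝ × ℝ) | 1 + |p.1| ≤ √3 * p.2.1} :=
      isClosed_le (by fun_prop) (by fun_prop)
    exact h1.inter h2
  have := m.measure_preimage hm.nullMeasurableSet
  rw [← Measure.volume_eq_prod] at this
  refine Eq.trans ?_ this
  rfl

def TT (a b c : EuclideanSpace ℝ (Fin 3)) : Set (EuclideanSpace ℝ (Fin 3)) :=
  {x | dist x a ≤ 1 ∧ dist x b ≤ dist x a ∧ dist x c ≤ dist x a}

lemma TT_closed (a b c) : IsClosed (TT a b c) := by
  have h1 : IsClosed {x | dist x a ≤ 1} := isClosed_le (by fun_prop) (by fun_prop)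
  have h2 : IsClosed {x | dist x b ≤ dist x a} := isClosed_le (by fun_prop) (by fun_prop)
  have h3 : IsClosed {x | dist x c ≤ dist x a} := isClosed_le (by fun_prop) (by fun_prop)
  exact h1.inter (h2.inter h3)

lemma TT_vol (a b c : EuclideanSpace ℝ (Fin 3))
    (hab : dist a b = 1) (hac : dist a c = 1) (hbc : dist b c = 1) :
    volume (TT a b c) = ENNReal.ofReal ((1/36) * (2 * √2 + 24 * π - 57 * arccos (1/3))) := by
  rw [← PP_vol]
  set p := b - a with hp
  set q := c - a with hq
  have h3 : √3 * √3 = 3 := Real.mul_self_sqrt (by norm_num)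
  have h30 : 0 < √3 := by positivity
  have pp : inner ℝ p p = 1 := by
    rw [real_inner_self_eq_norm_sq, hp, ← dist_eq_norm, dist_comm, hab]; norm_num
  have qq : inner ℝ q q = 1 := by
    rw [real_inner_self_eq_norm_sq, hq, ← dist_eq_norm, dist_comm, hac]; norm_num
  have pq : inner ℝ p q = 1/2 := by
    have h : inner ℝ (p - q) (p - q) = 1 := by
      rw [real_inner_self_eq_norm_sq, hp, hq, sub_sub_sub_cancel_right, ← dist_eq_norm, hbc]; norm_num
    rw [real_inner_sub_sub_self, pp, qq] at h; linarith
  have qp : inner ℝ q p = 1/2 := by rw [real_inner_comm, pq]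
  let f : Fin 3 → EuclideanSpace ℝ (Fin 3) := ![(1/√3) • (p + q), p - q, 0]
  have f00 : inner ℝ ((1/√3) • (p + q)) ((1/√3) • (p + q)) = 1 := by
    rw [real_inner_smul_left, real_inner_smul_right, inner_add_left, inner_add_right,
      inner_add_right, pp, qq, pq, qp]
    field_simp
    nlinarith
  have f01 : inner ℝ ((1/√3) • (p + q)) (p - q) = 0 := by
    rw [real_inner_smul_left, inner_add_left, inner_sub_right p p q, inner_sub_right q p q, pp, qq, pq, qp]
    ring
  have f11 : inner ℝ (p - q) (p - q) = 1 := by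
    rw [inner_sub_left, inner_sub_right p p q, inner_sub_right q p q, pp, qq, pq, qp]
    norm_num
  have f10 : inner ℝ (p - q) ((1/√3) • (p + q)) = 0 := by rw [real_inner_comm, f01]
  have hf : Orthonormal ℝ (({0, 1} : Set (Fin 3)).domRestrict f) := by
    rw [orthonormal_iff_ite]
    rintro ⟨i, hi⟩ ⟨j, hj⟩
    simp only [Set.mem_insert_iff, Set.mem_singleton_iff] at hi hj
    rcases hi with rfl | rfl <;> rcases hj with rfl | rfl
    · exact f00
    · exact f01
    · exact f10
    · exact f11
  obtain ⟨B, hB⟩ := hf.exists_orthonormalBasis_extension_of_card_eq (by simp)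
  have hB0 : B 0 = (1/√3) • (p + q) := hB 0 (by simp)
  have hB1 : B 1 = p - q := hB 1 (by simp)
  have m1 : MeasurePreserving (fun x : EuclideanSpace ℝ (Fin 3) => x - a) volume volume :=
    measurePreserving_sub_right volume a
  have m := B.measurePreserving_repr.comp m1
  rw [← m.measure_preimage PP_closed.measurableSet.nullMeasurableSet]
  congr 1
  ext x
  set v := x - a with hv
  have xa : dist x a = ‖v‖ := dist_eq_norm _ _
  have xb : dist x b = ‖v - p‖ := by rw [dist_eq_norm, hv, hp]; congr 1; abel
  have xc : dist x c = ‖v - q‖ := by rw [dist_eq_norm, hv, hq]; congr 1; abel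
  have k0 : √3 * B.repr v 0 = inner ℝ v p + inner ℝ v q := by
    rw [B.repr_apply_apply, hB0, real_inner_comm, inner_smul_right, inner_add_right]; field_simp
  have k1 : B.repr v 1 = inner ℝ v p - inner ℝ v q := by
    rw [B.repr_apply_apply, hB1, real_inner_comm, inner_sub_right]
  have kn : ‖v‖^2 = (B.repr v 0)^2 + (B.repr v 1)^2 + (B.repr v 2)^2 := by
    rw [← B.repr.norm_map v, EuclideanSpace.norm_sq_eq]
    simp [Fin.sum_univ_three]
  have cp : ‖v - p‖ ≤ ‖v‖ ↔ 1 ≤ 2 * inner ℝ v p := by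
    rw [← sq_le_sq₀ (norm_nonneg _) (norm_nonneg _), norm_sub_sq_real, ← real_inner_self_eq_norm_sq p, pp]
    constructor <;> intro h <;> linarith
  have cq : ‖v - q‖ ≤ ‖v‖ ↔ 1 ≤ 2 * inner ℝ v q := by
    rw [← sq_le_sq₀ (norm_nonneg _) (norm_nonneg _), norm_sub_sq_real, ← real_inner_self_eq_norm_sq q, qq]
    constructor <;> intro h <;> linarith
  have c1 : ‖v‖ ≤ 1 ↔ ‖v‖^2 ≤ 1 := by
    rw [sq_le_one_iff₀ (norm_nonneg _)]
  change (dist x a ≤ 1 ∧ dist x b ≤ dist x a ∧ dist x c ≤ dist x a) ↔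
    ((B.repr v 0)^2 + (B.repr v 1)^2 + (B.repr v 2)^2 ≤ 1 ∧ 1 + |B.repr v 1| ≤ √3 * B.repr v 0)
  rw [xa, xb, xc, cp, cq, c1, kn, k0, k1]
  refine and_congr Iff.rfl ?_
  rw [← le_sub_iff_add_le', abs_le]
  constructor
  · rintro ⟨h, h'⟩; constructor <;> linarith
  · rintro ⟨h, h'⟩; constructor <;> linarith

lemma bis_null (a b : EuclideanSpace ℝ (Fin 3)) (hab : dist a b = 1) (s)
    (hs : ∀ x ∈ s, dist x a = dist x b) : volume s = 0 := by
  have hne : AffineSubspace.perpBisector a b ≠ ⊤ := by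
    rw [Ne, AffineSubspace.perpBisector_eq_top]
    rintro rfl; simp at hab
  refine measure_mono_null ?_ (Measure.addHaar_affineSubspace volume _ hne)
  intro x hx
  exact AffineSubspace.mem_perpBisector_iff_dist_eq.2 (hs x hx)

theorem trihedron_volume (a b c : EuclideanSpace ℝ (Fin 3))
    (hab : dist a b = 1) (hac : dist a c = 1) (hbc : dist b c = 1) :
    volume (closedBall a 1 ∩ closedBall b 1 ∩ closedBall c 1) =
      ENNReal.ofReal ((1 / 12) * (2 * Real.sqrt 2 + 24 * π - 57 * Real.arccos (1 / 3))) := by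
  have hU : closedBall a 1 ∩ closedBall b 1 ∩ closedBall c 1 = TT a b c ∪ TT b a c ∪ TT c a b := by
    ext x
    simp only [Set.mem_inter_iff, mem_closedBall, Set.mem_union, TT, Set.mem_ofPred_eq]
    grind
  have d1 : AEDisjoint volume (TT a b c) (TT b a c) :=
    bis_null a b hab _ (fun x hx => le_antisymm hx.2.2.1 hx.1.2.1)
  have d2 : AEDisjoint volume (TT a b c ∪ TT b a c) (TT c a b) := by
    rw [AEDisjoint.union_left_iff]
    exact ⟨bis_null a c hac _ (fun x hx => le_antisymm hx.2.2.1 hx.1.2.2),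
      bis_null b c hbc _ (fun x hx => le_antisymm hx.2.2.2 hx.1.2.2)⟩
  rw [hU, measure_union₀ (TT_closed _ _ _).measurableSet.nullMeasurableSet d2,
    measure_union₀ (TT_closed _ _ _).measurableSet.nullMeasurableSet d1,
    TT_vol a b c hab hac hbc, TT_vol b a c (by rw [dist_comm, hab]) hbc hac,
    TT_vol c a b (by rw [dist_comm, hac]) (by rw [dist_comm, hbc]) hab]
  have hnn : 0 ≤ (1/36) * (2 * √2 + 24 * π - 57 * arccos (1/3)) := by
    have : 0 ≤ ∫ y in (0:ℝ)..(1/2), hh y :=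
      intervalIntegral.integral_nonneg (by norm_num) (fun y hy => (hh_nonneg y hy.1 hy.2).1)
    rw [hh_integral] at this; linarith
  rw [← ENNReal.ofReal_add hnn hnn, ← ENNReal.ofReal_add (by linarith) hnn]
  congr 1; ring
end

section
/- Let a, b, c, d ∈ ℝ³ be pairwise at distance 1 from each other. Then the Lebesgue volume of the intersection closedBall a 1 ∩ closedBall b 1 ∩ closedBall c 1 ∩ closedBall d 1 (the Reuleaux tetrahedron) equals (1/12)·[3√2 + 32π − 81·arccos(1/3)]. -/
open MeasureTheory Metric Real

lemma lint_ftc {f F : ℝ → ℝ} {a b : ℝ} (hab : a ≤ b)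
    (hF : ∀ x ∈ Set.Icc a b, HasDerivAt F (f x) x) (hf : ContinuousOn f (Set.Icc a b))
    (h0 : ∀ x ∈ Set.Icc a b, 0 ≤ f x) :
    ∫⁻ x in Set.Ioc a b, ENNReal.ofReal (f x) = ENNReal.ofReal (F b - F a) := by
  have hi : IntervalIntegrable f volume a b := by
    apply ContinuousOn.intervalIntegrable
    rwa [Set.uIcc_of_le hab]
  rw [← intervalIntegral.integral_eq_sub_of_hasDerivAt (f := F) (f' := f) (by
    rwa [Set.uIcc_of_le hab]) hi, intervalIntegral.integral_of_le hab,
    ofReal_integral_eq_lintegral_ofReal]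
  · exact (intervalIntegrable_iff_integrableOn_Ioc_of_le hab).1 hi
  · filter_upwards [ae_restrict_mem measurableSet_Ioc] with x hx
    exact h0 x ⟨hx.1.le, hx.2⟩

/-- the chamber in coordinates -/
def Q3 : Set (ℝ × ℝ × ℝ) :=
  {p | 1/2 < p.1 ∧ p.1 < √3 * p.2.1 ∧ p.2.1 < √2 * p.2.2 ∧ p.1^2 + p.2.1^2 + p.2.2^2 ≤ 1}

lemma Q3_meas : MeasurableSet Q3 := by
  unfold Q3
  measurability

def Q4 : Set (ℝ × ℝ × ℝ) :=
  {p | 1/2 < p.1 ∧ p.1 < √3 * p.2.1 ∧ 1 < √2 * p.2.2 ∧ p.1^2 + p.2.1^2 * (1 + p.2.2^2) ≤ 1}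

lemma Q4_meas : MeasurableSet Q4 := by
  unfold Q4
  measurability

noncomputable def fQ (s u t : ℝ) : ENNReal := ENNReal.ofReal u * Q4.indicator 1 (s, u, t)

lemma fQ_meas : Measurable (fun p : ℝ × ℝ × ℝ => fQ p.1 p.2.1 p.2.2) := by
  unfold fQ
  have := (measurable_one (α := ENNReal) (β := ℝ × ℝ × ℝ)).indicator Q4_meas
  fun_prop

lemma vol_Q3_eq : volume Q3 = ∫⁻ t, ∫⁻ s, ∫⁻ u, fQ s u t := by
  have h1 : volume Q3 = ∫⁻ s, ∫⁻ u, ∫⁻ t, fQ s u t := by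
    rw [Measure.volume_eq_prod, Measure.prod_apply Q3_meas]
    congr 1; ext s
    rw [Measure.volume_eq_prod, Measure.prod_apply (measurable_prodMk_left Q3_meas)]
    congr 1; ext u
    have hm : MeasurableSet ((fun t => (s, u, t)) ⁻¹' Q4) :=
      (by fun_prop : Measurable (fun t : ℝ => (s, u, t))) Q4_meas
    have h2 : ∫⁻ t, fQ s u t = ENNReal.ofReal u * volume ((fun t => (s, u, t)) ⁻¹' Q4) := by
      unfold fQ
      rw [lintegral_const_mul' _ _ ENNReal.ofReal_ne_top, ← lintegral_indicator_one hm]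
      rfl
    rw [h2]
    by_cases hu : 0 < u
    · have : (fun t => (s, u, t)) ⁻¹' Q4 = (fun t => u * t) ⁻¹' (Prod.mk u ⁻¹' (Prod.mk s ⁻¹' Q3)) := by
        ext t
        simp only [Q3, Q4, Set.mem_preimage, Set.mem_ofPred_eq]
        have e1 : (u < √2 * (u * t)) ↔ 1 < √2 * t := by
          rw [show √2 * (u * t) = u * (√2 * t) by ring]
          exact lt_mul_iff_one_lt_right hu
        rw [e1, show s^2 + u^2 + (u*t)^2 = s^2 + u^2 * (1+t^2) by ring]
      rw [this, Real.volume_preimage_mul_left hu.ne', ← mul_assoc, ← ENNReal.ofReal_mul hu.le,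
        abs_of_pos (by positivity), mul_inv_cancel₀ hu.ne']
      simp
    · have : Prod.mk u ⁻¹' (Prod.mk s ⁻¹' Q3) = ∅ := by
        ext t
        simp only [Q3, Set.mem_preimage, Set.mem_ofPred_eq, Set.mem_empty_iff_false, iff_false]
        rintro ⟨h1, h2, -⟩
        have := mul_nonneg (Real.sqrt_nonneg 3) (by linarith : 0 ≤ -u)
        linarith
      rw [this, ENNReal.ofReal_of_nonpos (by linarith)]
      simp
  rw [h1]
  have h2 : ∀ s, ∫⁻ u, ∫⁻ t, fQ s u t = ∫⁻ t, ∫⁻ u, fQ s u t := by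
    intro s
    apply lintegral_lintegral_swap
    exact (fQ_meas.comp (by fun_prop : Measurable (fun p : ℝ × ℝ => (s, p.1, p.2)))).aemeasurable
  simp_rw [h2]
  apply lintegral_lintegral_swap
  have : Measurable (fun q : (ℝ × ℝ) × ℝ => fQ q.1.1 q.2 q.1.2) :=
    fQ_meas.comp (by fun_prop : Measurable (fun q : (ℝ × ℝ) × ℝ => (q.1.1, q.2, q.1.2)))
  exact (this.lintegral_prod_right').aemeasurable

lemma inner_u {s t : ℝ} (hs : 1/2 < s) (ht : 1 < √2 * t) :
    ∫⁻ u, fQ s u t = ENNReal.ofReal (1/2 * ((1 - s^2)/(1+t^2) - s^2/3)) := by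
  have h3 : 0 < √3 := by positivity
  have h33 : √3 ^ 2 = 3 := Real.sq_sqrt (by norm_num)
  set R := √((1 - s^2)/(1+t^2)) with hR
  have hset : ∀ u, fQ s u t = (Set.Ioc (s/√3) R).indicator (fun u => ENNReal.ofReal u) u := by
    intro u
    unfold fQ
    have : (s,u,t) ∈ Q4 ↔ u ∈ Set.Ioc (s/√3) R := by
      simp only [Q4, Set.mem_ofPred_eq, Set.mem_Ioc, hs, ht, true_and, div_lt_iff₀' h3]
      apply and_congr_right
      intro h
      have hu : 0 < u := by
        have : 0 < √3 * u := by linarith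
        exact (pos_iff_pos_of_mul_pos this).1 h3
      rw [hR, Real.le_sqrt' hu, le_div_iff₀ (by positivity)]
      constructor <;> intro h <;> linarith
    by_cases h : u ∈ Set.Ioc (s/√3) R
    · rw [Set.indicator_of_mem h, Set.indicator_of_mem (this.2 h)]; simp
    · rw [Set.indicator_of_notMem h, Set.indicator_of_notMem (fun h' => h (this.1 h'))]; simp
  simp_rw [hset]
  rw [lintegral_indicator measurableSet_Ioc]
  have hs3 : 0 < s / √3 := by positivity
  by_cases hle : s/√3 ≤ R
  · rw [lint_ftc (f := fun u => u) (F := fun u => 1/2 * u^2) hle]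
    · congr 1
      have : 0 ≤ (1 - s^2)/(1+t^2) := by
        by_contra hneg
        have : R = 0 := Real.sqrt_eq_zero_of_nonpos (by linarith)
        linarith
      rw [hR, Real.sq_sqrt this, div_pow, h33]; ring
    · intro x _
      have := ((hasDerivAt_id x).pow 2).const_mul (1/2)
      exact this.congr_deriv (by simp)
    · exact continuousOn_id
    · intro x hx
      exact hs3.le.trans hx.1
  · rw [Set.Ioc_eq_empty (by intro h; exact hle h.le), ENNReal.ofReal_of_nonpos]
    · simp
    · push Not at hle
      rw [hR, Real.sqrt_lt' hs3, div_pow, h33] at hle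
      linarith

noncomputable def Gf (t : ℝ) : ℝ := (1/(3*√((4+t^2)/3)) - 1/4 + (4+t^2)/144)/(1+t^2)

lemma inner_s {t : ℝ} (ht : 1 < √2 * t) (ht' : t ≤ 2 * √2) :
    ∫⁻ s, ∫⁻ u, fQ s u t = ENNReal.ofReal (Gf t) := by
  have h22 : √2 ^ 2 = 2 := Real.sq_sqrt (by norm_num)
  have h2 : 0 < √2 := by positivity
  have htp : 0 < t := by
    have : 0 < √2 * t := by linarith
    exact (pos_iff_pos_of_mul_pos this).1 h2
  have ht8 : t^2 ≤ 8 := by nlinarith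
  set A := (4+t^2)/3 with hA
  have hAp : 0 < A := by positivity
  have hA4 : A ≤ 4 := by linarith
  set q := √A with hq
  have hqp : 0 < q := by positivity
  have hq2 : q^2 = A := Real.sq_sqrt hAp.le
  have hq2' : q ≤ 2 := by nlinarith
  have hset : ∀ s, ∫⁻ u, fQ s u t = (Set.Ioc (1/2) (1/q)).indicator
      (fun s => ENNReal.ofReal (1/2 * ((1 - s^2)/(1+t^2) - s^2/3))) s := by
    intro s
    by_cases hs : 1/2 < s
    · rw [inner_u hs ht]
      by_cases h : s ≤ 1/q
      · rw [Set.indicator_of_mem (Set.mem_Ioc.2 ⟨hs, h⟩)]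
      · rw [Set.indicator_of_notMem (fun h' => h h'.2), ENNReal.ofReal_of_nonpos]
        push Not at h
        rw [div_lt_iff₀ hqp] at h
        have : 1 < s^2 * A := by rw [← hq2]; nlinarith
        have : (1 - s^2)/(1+t^2) - s^2/3 = (1 - s^2 * A)/(1+t^2) := by
          rw [hA]; field_simp; ring
        rw [this]
        have : (1 - s^2 * A)/(1+t^2) ≤ 0 := div_nonpos_of_nonpos_of_nonneg (by linarith) (by positivity)
        linarith
    · rw [Set.indicator_of_notMem (fun h' => hs h'.1)]
      have : ∀ u, fQ s u t = 0 := by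
        intro u
        unfold fQ
        rw [Set.indicator_of_notMem (fun h' => hs h'.1), mul_zero]
      simp [this]
  simp_rw [hset]
  rw [lintegral_indicator measurableSet_Ioc]
  rw [lint_ftc (F := fun s => 1/2 * ((s - s^3/3)/(1+t^2) - s^3/9))]
  · congr 1
    unfold Gf
    rw [← hA, ← hq]
    have : t^2 = 3 * q^2 - 4 := by rw [hq2, hA]; ring
    have h1 : 1 + t^2 ≠ 0 := by positivity
    rw [this] at h1 ⊢
    have h1' : q^2 * 3 - 3 ≠ 0 := by intro h; apply h1; linarith
    have h1' : q^2 - 1 ≠ 0 := by intro h; apply h1; linarith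
    rw [show (1 + (3 * q^2 - 4)) = 3 * (q^2 - 1) by ring]
    field_simp
    ring
  · rw [le_div_iff₀ hqp]; linarith
  · intro x _
    have h1 := (hasDerivAt_id x)
    have h3 := (hasDerivAt_id x).pow 3
    have := (((h1.sub (h3.div_const 3)).div_const (1+t^2)).sub (h3.div_const 9)).const_mul (1/2)
    exact this.congr_deriv (by simp; ring)
  · fun_prop
  · intro s hs
    have hsq : s * q ≤ 1 := by rw [← le_div_iff₀ hqp]; exact hs.2
    have hs0 : 0 < s := by linarith [hs.1]
    have : s^2 * A ≤ 1 := by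
      rw [← hq2, ← mul_pow]; exact pow_le_one₀ (by positivity) hsq
    have e : (1 - s^2)/(1+t^2) - s^2/3 = (1 - s^2 * A)/(1+t^2) := by
      rw [hA]; field_simp; ring
    rw [e]
    have : 0 ≤ 1 - s^2*A := by linarith
    positivity

lemma inner_s' {t : ℝ} (ht' : 2 * √2 < t) :
    ∫⁻ s, ∫⁻ u, fQ s u t = 0 := by
  have h22 : √2 ^ 2 = 2 := Real.sq_sqrt (by norm_num)
  have h33 : √3 ^ 2 = 3 := Real.sq_sqrt (by norm_num)
  have h2 : 0 < √2 := by positivity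
  have h3 : 0 < √3 := by positivity
  have ht8 : 8 < t^2 := by nlinarith
  have : ∀ s u, fQ s u t = 0 := by
    intro s u
    unfold fQ
    rw [Set.indicator_of_notMem, mul_zero]
    rintro ⟨h1, h2, h3', h4⟩
    simp only at h1 h2 h3' h4
    have : s^2 < 3 * u^2 := by rw [← h33, ← mul_pow]; exact pow_lt_pow_left₀ h2 (by linarith) (by norm_num)
    nlinarith
  simp [this]

noncomputable def GF (t : ℝ) : ℝ :=
  1/3 * Real.arctan (√3 * t / √(4+t^2)) - 1/4 * Real.arctan t + (t + 3 * Real.arctan t)/144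

lemma GF_deriv (t : ℝ) : HasDerivAt GF (Gf t) t := by
  have h4 : (0:ℝ) < 4 + t^2 := by positivity
  have hr2 : √(4+t^2)^2 = 4 + t^2 := Real.sq_sqrt h4.le
  have hsq : HasDerivAt (fun t : ℝ => √(4+t^2)) ((2*t)/(2*√(4+t^2))) t := by
    have := (((hasDerivAt_id t).pow 2).const_add 4).sqrt (by simpa using h4.ne')
    exact this.congr_deriv (by simp)
  have hrp : 0 < √(4+t^2) := by positivity
  have hat := Real.hasDerivAt_arctan t
  have hin := (((hasDerivAt_id t).const_mul √3).div hsq hrp.ne').arctan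
  have := ((hin.const_mul (1/3)).sub (hat.const_mul (1/4))).add
    (((hasDerivAt_id t).add (hat.const_mul 3)).div_const 144)
  refine this.congr_deriv (Eq.symm ?_)
  unfold Gf
  rw [Real.sqrt_div h4.le]
  have h33 : √3 ^ 2 = 3 := Real.sq_sqrt (by norm_num)
  have h3 : 0 < √3 := by positivity
  simp only [id]
  set r := √(4+t^2)
  set w := √3
  have : t^2 = r^2 - 4 := by linarith
  have e1 : 1 + (w * t / r)^2 = 4 * (1 + t^2) / r^2 := by
    rw [div_pow, mul_pow, h33]; field_simp; rw [hr2]; ring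
  have e2 : (w * 1 * r - w * t * (2 * t / (2 * r))) / r^2 = w * 4 / r^3 := by
    field_simp; rw [hr2]; ring
  simp only [Pi.div_apply, Pi.add_apply] at *
  rw [e1, e2]
  have h1 : (0:ℝ) < 1 + t^2 := by positivity
  field_simp
  ring_nf
  try nlinarith

lemma Gf_nonneg (t : ℝ) : 0 ≤ Gf t := by
  unfold Gf
  have hAp : 0 < (4+t^2)/3 := by positivity
  have hq2 : √((4+t^2)/3)^2 = (4+t^2)/3 := Real.sq_sqrt hAp.le
  have hqp : 0 < √((4+t^2)/3) := by positivity
  set q := √((4+t^2)/3)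
  have : 1/(3*q) - 1/4 + (4+t^2)/144 = (q-2)^2*(q+4)/(48*q) := by
    rw [show (4+t^2)/144 = q^2/48 by rw [hq2]; ring]
    field_simp; ring
  rw [this]; positivity

lemma Gf_cont : Continuous Gf := by
  unfold Gf
  have h : ∀ t : ℝ, 3 * √((4+t^2)/3) ≠ 0 := fun t => by positivity
  have h' : ∀ t : ℝ, 1 + t^2 ≠ 0 := fun t => by positivity
  fun_prop (disch := assumption)

lemma GF_val : GF (2*√2) - GF (1/√2) =
    1/24 * ((1 / 12) * (3 * √2 + 32 * π - 81 * Real.arccos (1 / 3))) := by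
  have h2 : 0 < √2 := by positivity
  have h22 : √2 ^ 2 = 2 := Real.sq_sqrt (by norm_num)
  have h3 : 0 < √3 := by positivity
  have h33 : √3 ^ 2 = 3 := Real.sq_sqrt (by norm_num)
  have b1 : Real.arctan (2*√2) = Real.arccos (1/3) := by
    rw [Real.arccos_eq_arctan (by norm_num)]
    congr 1
    have : √(1 - (1/3:ℝ)^2) = 2*√2/3 := by
      rw [Real.sqrt_eq_iff_mul_self_eq (by norm_num) (by positivity)]
      nlinarith
    rw [this]; ring
  have b2 : 2 * Real.arctan (1/√2) = Real.arccos (1/3) := by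
    rw [← b1, Real.two_mul_arctan]
    · congr 1
      rw [div_pow, h22]
      field_simp
      nlinarith
    · have : 0 < 1/√2 := by positivity
      linarith
    · rw [div_lt_one h2]; nlinarith
  have b3 : Real.arctan √2 = π/2 - Real.arctan (1/√2) := by
    rw [one_div, Real.arctan_inv_of_pos h2]; ring
  have c1 : √3 * (2*√2) / √(4+(2*√2)^2) = √2 := by
    have : √(4+(2*√2)^2) = 2*√3 := by
      rw [Real.sqrt_eq_iff_mul_self_eq (by positivity) (by positivity)]
      nlinarith
    rw [this]; field_simp
  have c2 : √3 * (1/√2) / √(4+(1/√2)^2) = (√3)⁻¹ := by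
    have : √(4+(1/√2)^2) = 3/√2 := by
      rw [Real.sqrt_eq_iff_mul_self_eq (by positivity) (by positivity)]
      field_simp; rw [h22]; norm_num
    rw [this]; field_simp; exact h33
  have d : 1/√2 = √2/2 := by field_simp; linarith
  unfold GF
  rw [c1, c2, b1, b3, Real.arctan_inv_sqrt_three]
  have : Real.arctan (1/√2) = Real.arccos (1/3) / 2 := by linarith
  rw [this, d]
  ring

lemma vol_Q3 : volume Q3 = ENNReal.ofReal
    (1/24 * ((1 / 12) * (3 * √2 + 32 * π - 81 * Real.arccos (1 / 3)))) := by
  have h2 : 0 < √2 := by positivity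
  have h22 : √2 ^ 2 = 2 := Real.sq_sqrt (by norm_num)
  rw [vol_Q3_eq, ← GF_val]
  have hset : ∀ t, ∫⁻ s, ∫⁻ u, fQ s u t = (Set.Ioc (1/√2) (2*√2)).indicator
      (fun t => ENNReal.ofReal (Gf t)) t := by
    intro t
    by_cases ht : 1/√2 < t
    · by_cases ht' : t ≤ 2*√2
      · rw [Set.indicator_of_mem (Set.mem_Ioc.2 ⟨ht, ht'⟩), inner_s _ ht']
        rwa [div_lt_iff₀' h2] at ht
      · rw [Set.indicator_of_notMem (fun h' => ht' h'.2), inner_s' (by linarith)]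
    · rw [Set.indicator_of_notMem (fun h' => ht h'.1)]
      have : ∀ s u, fQ s u t = 0 := by
        intro s u
        unfold fQ
        rw [Set.indicator_of_notMem, mul_zero]
        intro h
        exact ht (by rw [div_lt_iff₀' h2]; exact h.2.2.1)
      simp [this]
  simp_rw [hset]
  rw [lintegral_indicator measurableSet_Ioc]
  apply lint_ftc
  · rw [div_le_iff₀ h2]; nlinarith
  · intro t _; exact GF_deriv t
  · exact Gf_cont.continuousOn
  · intro t _; exact Gf_nonneg t

abbrev E3 := EuclideanSpace ℝ (Fin 3)

/-- one of the 24 chambers of the Reuleaux tetrahedron -/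
def Piece (p : Fin 4 → E3) : Set E3 :=
  {x | dist x (p 0) < dist x (p 1) ∧ dist x (p 1) < dist x (p 2) ∧ dist x (p 2) < dist x (p 3) ∧
    dist x (p 3) ≤ 1}

lemma inner_half {a c d : E3} (hac : dist a c = 1) (had : dist a d = 1) (hcd : dist c d = 1) :
    inner ℝ (a - d) (c - d) = 1/2 := by
  rw [dist_eq_norm] at *
  have h := norm_sub_sq_real (a - d) (c - d)
  rw [sub_sub_sub_cancel_right, hac, had, hcd] at h
  linarith

lemma dist_lt_iff {x a c d : E3} (had : dist a d = 1) (hcd : dist c d = 1) :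
    dist x a < dist x c ↔ inner ℝ (c - d) (x - d) < inner ℝ (a - d) (x - d) := by
  rw [dist_eq_norm] at *
  rw [dist_eq_norm, ← sq_lt_sq₀ (norm_nonneg _) (norm_nonneg _),
    ← sub_sub_sub_cancel_right x a d, ← sub_sub_sub_cancel_right x c d,
    norm_sub_sq_real (x - d) (a - d), norm_sub_sq_real (x - d) (c - d), had, hcd, real_inner_comm (x - d) (a - d),
    real_inner_comm (x - d) (c - d)]
  constructor <;> intro h <;> linarith

lemma dist_lt_iff' {x c d : E3} (hcd : dist c d = 1) :
    dist x c < dist x d ↔ 1/2 < inner ℝ (c - d) (x - d) := by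
  rw [dist_eq_norm] at *
  rw [dist_eq_norm, ← sq_lt_sq₀ (norm_nonneg _) (norm_nonneg _),
    ← sub_sub_sub_cancel_right x c d,
    norm_sub_sq_real (x - d) (c - d), hcd, real_inner_comm (x - d) (c - d)]
  constructor <;> intro h <;> linarith

lemma coord_mp : MeasurePreserving (fun y : E3 => ((y 0, y 1, y 2) : ℝ × ℝ × ℝ)) := by
  have h1 := PiLp.volume_preserving_ofLp (Fin 3)
  have h2 := volume_preserving_piFinSuccAbove (fun _ : Fin 3 => ℝ) 0
  have h3 := (MeasurePreserving.id (volume : Measure ℝ)).prod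
    (volume_preserving_piFinTwo (fun _ : Fin 2 => ℝ))
  exact (h3.comp h2).comp h1

lemma piece_vol (p : Fin 4 → E3) (hp : ∀ i j, i ≠ j → dist (p i) (p j) = 1) :
    MeasurableSet (Piece p) ∧ volume (Piece p) = volume Q3 := by
  obtain ⟨d, hd⟩ : ∃ d, d = p 3 := ⟨_, rfl⟩
  obtain ⟨A, hA⟩ : ∃ A, A = p 1 - d := ⟨_, rfl⟩
  obtain ⟨B, hB⟩ : ∃ A, A = p 0 - d := ⟨_, rfl⟩
  obtain ⟨C, hC⟩ : ∃ A, A = p 2 - d := ⟨_, rfl⟩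
  have nA : inner ℝ A A = 1 := by
    rw [real_inner_self_eq_norm_sq, hA, hd, ← dist_eq_norm, hp _ _ (by decide)]; norm_num
  have nB : inner ℝ B B = 1 := by
    rw [real_inner_self_eq_norm_sq, hB, hd, ← dist_eq_norm, hp _ _ (by decide)]; norm_num
  have nC : inner ℝ C C = 1 := by
    rw [real_inner_self_eq_norm_sq, hC, hd, ← dist_eq_norm, hp _ _ (by decide)]; norm_num
  have iAB : inner ℝ A B = 1/2 := by
    rw [hA, hB, hd]
    exact inner_half (hp _ _ (by decide)) (hp _ _ (by decide)) (hp _ _ (by decide))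
  have iAC : inner ℝ A C = 1/2 := by
    rw [hA, hC, hd]
    exact inner_half (hp _ _ (by decide)) (hp _ _ (by decide)) (hp _ _ (by decide))
  have iBC : inner ℝ B C = 1/2 := by
    rw [hB, hC, hd]
    exact inner_half (hp _ _ (by decide)) (hp _ _ (by decide)) (hp _ _ (by decide))
  have iBA : inner ℝ B A = 1/2 := by rw [real_inner_comm]; exact iAB
  have iCA : inner ℝ C A = 1/2 := by rw [real_inner_comm]; exact iAC
  have iCB : inner ℝ C B = 1/2 := by rw [real_inner_comm]; exact iBC
  have h2 : 0 < √2 := by positivity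
  have h22 : √2 ^ 2 = 2 := Real.sq_sqrt (by norm_num)
  have h3 : 0 < √3 := by positivity
  have h33 : √3 ^ 2 = 3 := Real.sq_sqrt (by norm_num)
  let v : Fin 3 → E3 := ![C, (2/√3) • (A - (1/2:ℝ) • C),
    (√3 * √2 / 2) • (B - (1/3:ℝ) • A - (1/3:ℝ) • C)]
  have hv : Orthonormal ℝ v := by
    rw [orthonormal_iff_ite]
    intro i j
    fin_cases i <;> fin_cases j <;>
      simp [v, inner_smul_left, inner_smul_right, inner_sub_left, inner_sub_right,
        -inner_self_eq_norm_sq_to_K, nA, nB, nC,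
        iAB, iAC, iBC, iBA, iCA, iCB] <;> norm_num
    · field_simp; linarith
    · ring_nf
    · ring_nf; rw [h22, h33]; norm_num
  let bas := basisOfOrthonormalOfCardEqFinrank hv (by simp)
  have hbas : ⇑bas = v := coe_basisOfOrthonormalOfCardEqFinrank hv (by simp)
  let ob : OrthonormalBasis (Fin 3) ℝ E3 := bas.toOrthonormalBasis (by rw [hbas]; exact hv)
  have hob : ⇑ob = v := by simp [ob, hbas]
  have hT := (coord_mp.comp ob.measurePreserving_repr).comp
    (measurePreserving_sub_right (volume : Measure E3) d)
  have key : Piece p = (((fun y : E3 => ((y 0, y 1, y 2) : ℝ × ℝ × ℝ)) ∘ ob.repr) ∘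
      fun x => x - d) ⁻¹' Q3 := by
    ext x
    have hn : ‖x - d‖^2 = (ob.repr (x-d) 0)^2 + (ob.repr (x-d) 1)^2 + (ob.repr (x-d) 2)^2 := by
      rw [← ob.repr.norm_map (x - d), EuclideanSpace.norm_sq_eq]
      simp [Fin.sum_univ_three]
    have r0 : ob.repr (x-d) 0 = inner ℝ C (x-d) := by
      rw [ob.repr_apply_apply, hob]; simp [v]
    have r1 : ob.repr (x-d) 1 = 2/√3 * (inner ℝ A (x-d) - 1/2 * inner ℝ C (x-d)) := by
      rw [ob.repr_apply_apply, hob]; simp [v, inner_smul_left, inner_sub_left]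
    have r2 : ob.repr (x-d) 2 = √3 * √2 / 2 * (inner ℝ B (x-d) - 1/3 * inner ℝ A (x-d)
        - 1/3 * inner ℝ C (x-d)) := by
      rw [ob.repr_apply_apply, hob]; simp [v, inner_smul_left, inner_sub_left]
    simp only [Piece, Q3, Set.mem_preimage, Set.mem_ofPred_eq, Function.comp_apply]
    rw [← hn, r0, r1, r2, dist_lt_iff (hp 0 3 (by decide)) (hp 1 3 (by decide)),
      dist_lt_iff (hp 1 3 (by decide)) (hp 2 3 (by decide)), dist_lt_iff' (hp 2 3 (by decide)),
      ← hd, ← hA, ← hB, ← hC, dist_eq_norm]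
    generalize inner ℝ A (x-d) = α
    generalize inner ℝ B (x-d) = β
    generalize inner ℝ C (x-d) = γ
    have e1 : √3 * (2/√3 * (α - 1/2 * γ)) = 2 * α - γ := by field_simp
    have e2 : √2 * (√3 * √2 / 2 * (β - 1/3*α - 1/3*γ)) = √3 * (β - 1/3*α - 1/3*γ) := by
      linear_combination (√3 / 2 * (β - 1/3*α - 1/3*γ)) * h22
    have e3 : 2/√3 * (α - 1/2*γ) < √3 * (β - 1/3*α - 1/3*γ) ↔ α < β := by
      rw [div_mul_eq_mul_div, div_lt_iff₀ h3]
      have : √3 * (β - 1/3*α - 1/3*γ) * √3 = 3 * (β - 1/3*α - 1/3*γ) := by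
        linear_combination (β - 1/3*α - 1/3*γ) * h33
      rw [this]
      constructor <;> intro h <;> linarith
    rw [e1, e2, e3, sq_le_one_iff₀ (norm_nonneg _)]
    constructor
    · rintro ⟨h1, h2, h3, h4⟩
      exact ⟨h3, by linarith, h1, h4⟩
    · rintro ⟨h1, h2, h3, h4⟩
      exact ⟨h3, by linarith, h1, h4⟩
  rw [key]
  exact ⟨hT.measurable Q3_meas, hT.measure_preimage Q3_meas.nullMeasurableSet⟩

lemma ae_dist_ne {a b : E3} (h : a ≠ b) : ∀ᵐ x : E3, dist x a ≠ dist x b := by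
  have h0 := Measure.addHaar_affineSubspace (volume : Measure E3) (AffineSubspace.perpBisector a b)
    (by rw [Ne, AffineSubspace.perpBisector_eq_top]; exact h)
  rw [ae_iff]
  convert h0 using 2
  ext x
  simp [AffineSubspace.mem_perpBisector_iff_dist_eq]

lemma piece_iff (p : Fin 4 → E3) (x : E3) :
    x ∈ Piece p ↔ StrictMono (fun i => dist x (p i)) ∧ dist x (p 3) ≤ 1 := by
  rw [Fin.strictMono_iff_lt_succ]
  simp [Piece, Fin.forall_fin_succ, and_assoc]

lemma reuleaux_aux (p : Fin 4 → E3) (hp : ∀ i j, i ≠ j → dist (p i) (p j) = 1) :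
    volume {x | ∀ i, dist x (p i) ≤ 1} = 24 * volume Q3 := by
  have hpσ : ∀ σ : Equiv.Perm (Fin 4), ∀ i j, i ≠ j → dist ((p ∘ σ) i) ((p ∘ σ) j) = 1 :=
    fun σ i j hij => hp _ _ (fun h => hij (σ.injective h))
  have hae : ∀ᵐ x : E3, Function.Injective (fun i => dist x (p i)) := by
    have : ∀ i j, i ≠ j → ∀ᵐ x : E3, dist x (p i) ≠ dist x (p j) := by
      intro i j hij
      apply ae_dist_ne
      intro h
      have := hp i j hij
      rw [h, dist_self] at this
      norm_num at this
    have h' : ∀ᵐ x : E3, ∀ i j, i ≠ j → dist x (p i) ≠ dist x (p j) := by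
      rw [ae_all_iff]; intro i
      rw [ae_all_iff]; intro j
      by_cases hij : i = j
      · simp [hij]
      · filter_upwards [this i j hij] with x hx _ using hx
    filter_upwards [h'] with x hx i j hij
    by_contra h
    exact hx i j h hij
  have hU : ({x | ∀ i, dist x (p i) ≤ 1} : Set E3) =ᵐ[volume]
      ⋃ σ : Equiv.Perm (Fin 4), Piece (p ∘ σ) := by
    filter_upwards [hae] with x hx
    apply propext
    change (∀ i, dist x (p i) ≤ 1) ↔ x ∈ ⋃ σ : Equiv.Perm (Fin 4), Piece (p ∘ σ)
    simp only [Set.mem_iUnion, piece_iff]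
    constructor
    · intro h
      refine ⟨Tuple.sort (fun i => dist x (p i)), ?_, h _⟩
      exact (Tuple.monotone_sort (fun i => dist x (p i))).strictMono_of_injective
        (hx.comp (Equiv.injective _))
    · rintro ⟨σ, h1, h2⟩ i
      have := h1.monotone (Fin.le_last (σ.symm i))
      simp only [Function.comp_apply, Equiv.apply_symm_apply] at this
      exact this.trans h2
  rw [measure_congr hU, measure_iUnion _ (fun σ => (piece_vol _ (hpσ σ)).1)]
  · simp_rw [fun σ => (piece_vol _ (hpσ σ)).2]
    rw [tsum_fintype]
    simp [Fintype.card_perm, Nat.factorial]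
  · intro σ τ hne
    rw [Function.onFun, Set.disjoint_left]
    intro x h1 h2
    rw [piece_iff] at h1 h2
    apply hne
    have hr : Set.range (fun i => dist x ((p ∘ σ) i)) = Set.range (fun i => dist x ((p ∘ τ) i)) := by
      have e1 := σ.surjective.range_comp (fun i => dist x (p i))
      have e2 := τ.surjective.range_comp (fun i => dist x (p i))
      exact e1.trans e2.symm
    have he := (h1.1.range_inj h2.1).1 hr
    have hinj : Function.Injective (fun i => dist x (p i)) := by
      have := h1.1.injective.comp σ.symm.injective
      convert this using 2
      simp
    ext i
    exact congrArg Fin.val (hinj (congrFun he i))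

theorem reuleaux_volume (a b c d : EuclideanSpace ℝ (Fin 3))
    (hab : dist a b = 1) (hac : dist a c = 1) (had : dist a d = 1)
    (hbc : dist b c = 1) (hbd : dist b d = 1) (hcd : dist c d = 1) :
    volume (closedBall a 1 ∩ closedBall b 1 ∩ closedBall c 1 ∩ closedBall d 1) =
      ENNReal.ofReal ((1 / 12) * (3 * Real.sqrt 2 + 32 * π - 81 * Real.arccos (1 / 3))) := by
  have h := reuleaux_aux ![a, b, c, d] (by
    intro i j hij
    fin_cases i <;> fin_cases j <;> first | exact absurd rfl hij | skip
    all_goals simp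
    all_goals first | assumption | (rw [dist_comm]; assumption))
  have hs : closedBall a 1 ∩ closedBall b 1 ∩ closedBall c 1 ∩ closedBall d 1 =
      {x | ∀ i, dist x (![a, b, c, d] i) ≤ 1} := by
    ext x
    simp [Fin.forall_fin_succ, and_assoc]
  rw [hs, h, vol_Q3, show (24 : ENNReal) = ENNReal.ofReal 24 by simp,
    ← ENNReal.ofReal_mul (by norm_num)]
  congr 1
  ring
end
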